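/- arXiv:0808.1683 — 2 statements merged into one kernel-verified Lean document; each statement's English description precedes it below -/
import Mathlib

section
/- Let φ₁ and φ₂ be idempotent states on a finite quantum group A. Then there exists an idempotent state ψ on A (denoted φ₁ ∨ φ₂) such that: (1) for every a ∈ A the Cesàro averages (1/n)·Σ_{k=0}^{n-1} (φ₁ ⋆ φ₂)^{⋆ k}(a) converge to ψ(a) as n → ∞ (where (φ₁ ⋆ φ₂)^{⋆ 0} = ε and (φ₁ ⋆ φ₂)^{⋆ k} is the k-fold convolution power); (2) φ₁ ⋆ ψ = ψ = ψ ⋆ φ₁ and φ₂ ⋆ ψ = ψ = ψ ⋆ φ₂; and (3) for every idempotent state φ₃ with φ₁ ⋆ φ₃ = φ₃ and φ₂ ⋆ φ₃ = φ₃ one has ψ ⋆ φ₃ = φ₃. Hence ψ is the supremum of φ₁ and φ₂ for the order φ ≺ φ' iff φ ⋆ φ' = φ'. -/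
open TensorProduct HopfAlgebra
open scoped ComplexOrder

noncomputable section

variable {A : Type*} [Ring A] [StarRing A] [HopfAlgebra ℂ A]
  [StarModule ℂ A] [FiniteDimensional ℂ A]

/-- Convolution of linear functionals on a coalgebra: `φ ⋆ ψ := (φ ⊗ ψ) ∘ Δ`. -/
def conv (φ ψ : A →ₗ[ℂ] ℂ) : A →ₗ[ℂ] ℂ :=
  LinearMap.mul' ℂ ℂ ∘ₗ TensorProduct.map φ ψ ∘ₗ Coalgebra.comul

/-- A state: a unital positive linear functional. -/
def IsState (φ : A →ₗ[ℂ] ℂ) : Prop :=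
  φ 1 = 1 ∧ ∀ a : A, 0 ≤ φ (star a * a)

/-- An idempotent state: a state satisfying `φ ⋆ φ = φ`. -/
def IsIdempotentState (φ : A →ₗ[ℂ] ℂ) : Prop :=
  IsState φ ∧ conv φ φ = φ

/-- The Haar state axioms: a faithful state which is a trace and two-sided invariant,
`(h ⊗ id)(Δ a) = h(a)·1 = (id ⊗ h)(Δ a)`. -/
structure IsHaarState (h : A →ₗ[ℂ] ℂ) : Prop where
  state : IsState h
  faithful : ∀ a : A, h (star a * a) = 0 → a = 0
  left_inv : ∀ a : A,
    TensorProduct.lid ℂ A (TensorProduct.map h LinearMap.id (Coalgebra.comul a)) = h a • 1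
  right_inv : ∀ a : A,
    TensorProduct.rid ℂ A (TensorProduct.map LinearMap.id h (Coalgebra.comul a)) = h a • 1
  trace : ∀ a b : A, h (a * b) = h (b * a)

/-- The star-compatibility axioms of a finite quantum group (finite-dimensional Hopf
`*`-algebra): the comultiplication is `*`-preserving (with respect to the entrywise star
`tstar` on `A ⊗ A`, given as data), and the antipode is `*`-preserving and involutive. -/
structure StarAxioms (tstar : A ⊗[ℂ] A →+ A ⊗[ℂ] A) : Prop where
  tstar_tmul : ∀ a b : A, tstar (a ⊗ₜ[ℂ] b) = star a ⊗ₜ[ℂ] star b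
  comul_star : ∀ a : A, Coalgebra.comul (R := ℂ) (star a) = tstar (Coalgebra.comul a)
  antipode_star : ∀ a : A, antipode (R := ℂ) (star a) = star (antipode (R := ℂ) a)
  antipode_invol : ∀ a : A, antipode (R := ℂ) (antipode (R := ℂ) a) = a

/-- A group-like projection: a nonzero self-adjoint idempotent `p` with
`Δ(p)(1 ⊗ p) = p ⊗ p`. -/
def IsGroupLikeProjection (p : A) : Prop :=
  p ≠ 0 ∧ star p = p ∧ p * p = p ∧
    Coalgebra.comul (R := ℂ) p * ((1 : A) ⊗ₜ[ℂ] p) = p ⊗ₜ[ℂ] p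

/-- Convolution powers, with `φ^{⋆0} = ε` (the counit). -/
def convPow (φ : A →ₗ[ℂ] ℂ) : ℕ → (A →ₗ[ℂ] ℂ)
  | 0 => Coalgebra.counit
  | n + 1 => conv (convPow φ n) φ

section Hilbert

variable {E : Type*} [NormedAddCommGroup E] [InnerProductSpace ℂ E] [FiniteDimensional ℂ E]

theorem inner_eq_of_isFixedPt_contraction {T : E →ₗ[ℂ] E} (hT : ∀ x, ‖T x‖ ≤ ‖x‖) {u : E}
    (hu : T u = u) (y : E) : inner ℂ u (T y) = inner ℂ u y := by
  have key : LinearMap.adjoint T u = u := by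
    refine eq_of_norm_le_re_inner_eq_norm_sq (𝕜 := ℂ) ?_ ?_
    · have h1 : ‖LinearMap.adjoint T u‖ ^ 2 ≤ ‖u‖ * ‖LinearMap.adjoint T u‖ := by
        rw [← inner_self_eq_norm_sq (𝕜 := ℂ), LinearMap.adjoint_inner_left]
        exact (re_inner_le_norm _ _).trans (by gcongr; exact hT _)
      by_contra! hlt
      nlinarith [norm_nonneg u]
    · rw [LinearMap.adjoint_inner_left, hu, inner_self_eq_norm_sq]
  rw [← LinearMap.adjoint_inner_left, key]

theorem isSymmetric_of_idempotent_contraction {T : E →ₗ[ℂ] E} (hT : ∀ x, ‖T x‖ ≤ ‖x‖)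
    (hi : T ∘ₗ T = T) : T.IsSymmetric := by
  have hfix (x : E) : T (T x) = T x := LinearMap.congr_fun hi x
  intro x y
  rw [← inner_eq_of_isFixedPt_contraction hT (hfix x) y, ← inner_conj_symm x,
    ← inner_eq_of_isFixedPt_contraction hT (hfix y) x, inner_conj_symm]

theorem exists_ergodic_projection {S T : E →ₗ[ℂ] E} (hS : ∀ x, ‖S x‖ ≤ ‖x‖)
    (hT : ∀ x, ‖T x‖ ≤ ‖x‖) (hSi : S ∘ₗ S = S) (hTi : T ∘ₗ T = T) :
    ∃ P : E →ₗ[ℂ] E, S ∘ₗ P = P ∧ P ∘ₗ S = P ∧ T ∘ₗ P = P ∧ P ∘ₗ T = P ∧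
      (∀ v, S v = v → T v = v → P v = v) ∧
      ∀ v, Filter.Tendsto
        (fun n : ℕ => (n : ℂ)⁻¹ • ∑ k ∈ Finset.range n, ((S ∘ₗ T) ^ k) v)
        Filter.atTop (nhds (P v)) := by
  have hSs := isSymmetric_of_idempotent_contraction hS hSi
  have hTs := isSymmetric_of_idempotent_contraction hT hTi
  set F : E →L[ℂ] E := LinearMap.toContinuousLinearMap (S ∘ₗ T) with hF
  have hFa (v : E) : F v = S (T v) := rfl
  have hFc : ‖F‖ ≤ 1 := F.opNorm_le_bound zero_le_one fun v => by
    rw [one_mul]; exact (hS _).trans (hT v)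
  set K := F.eqLocus (1 : E →L[ℂ] E)
  have hK {v : E} : v ∈ K ↔ S (T v) = v := Iff.rfl
  have hKS {v : E} (hv : v ∈ K) : S v = v := by
    have h1 := LinearMap.congr_fun hSi (T v)
    simp only [LinearMap.comp_apply, hK.1 hv] at h1
    exact h1
  have hKT {v : E} (hv : v ∈ K) : T v = v := by
    refine eq_of_norm_le_re_inner_eq_norm_sq (𝕜 := ℂ) (hT v) ?_
    have h1 : inner ℂ (T v) v = inner ℂ (T v) (T v) := by
      conv_lhs => rw [← LinearMap.congr_fun hTi v, LinearMap.comp_apply, hTs]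
    have h2 : ‖T v‖ = ‖v‖ := le_antisymm (hT v) (by
      conv_lhs => rw [← hK.1 hv]
      exact hS _)
    rw [h1, inner_self_eq_norm_sq, h2]
  have hmem (v : E) : K.starProjection v ∈ K := K.starProjection_apply_mem v
  have hPs := K.starProjection_isSymmetric
  have hcomp {R : E →ₗ[ℂ] E} (hR : R.IsSymmetric) (hRK : ∀ v ∈ K, R v = v) (v : E) :
      K.starProjection (R v) = K.starProjection v := by
    refine ext_inner_right ℂ fun w => ?_
    have h1 := hPs (R v) w
    have h2 := hPs v w
    simp only [ContinuousLinearMap.coe_coe] at h1 h2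
    rw [h1, h2, hR, hRK _ (hmem w)]
  refine ⟨K.starProjection, ?_, ?_, ?_, ?_, ?_, ?_⟩
  · ext v; exact hKS (hmem v)
  · ext v; exact hcomp hSs (fun _ => hKS) v
  · ext v; exact hKT (hmem v)
  · ext v; exact hcomp hTs (fun _ => hKT) v
  · intro v hSv hTv
    exact Submodule.starProjection_eq_self_iff.2 (hK.2 (by rw [hTv, hSv]))
  · intro v
    have : Filter.Tendsto (birkhoffAverage ℂ F _root_.id · v) Filter.atTop
        (nhds (K.starProjection v)) := F.tendsto_birkhoffAverage_orthogonalProjection hFc v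
    simpa [birkhoffAverage, birkhoffSum, Module.End.pow_apply, hF] using this

end Hilbert

theorem InnerProductSpace.Core.exists_ergodic_projection {V : Type*} [AddCommGroup V] [Module ℂ V]
    [FiniteDimensional ℂ V] (c : InnerProductSpace.Core ℂ V) {S T : V →ₗ[ℂ] V}
    (hS : ∀ x, (c.inner (S x) (S x)).re ≤ (c.inner x x).re)
    (hT : ∀ x, (c.inner (T x) (T x)).re ≤ (c.inner x x).re)
    (hSi : S ∘ₗ S = S) (hTi : T ∘ₗ T = T) :
    ∃ P : V →ₗ[ℂ] V, S ∘ₗ P = P ∧ P ∘ₗ S = P ∧ T ∘ₗ P = P ∧ P ∘ₗ T = P ∧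
      (∀ v, S v = v → T v = v → P v = v) ∧
      ∀ (f : V →ₗ[ℂ] ℂ) (v : V), Filter.Tendsto
        (fun n : ℕ => (n : ℂ)⁻¹ * ∑ k ∈ Finset.range n, f (((S ∘ₗ T) ^ k) v))
        Filter.atTop (nhds (f (P v))) := by
  let : NormedAddCommGroup V := c.toNormedAddCommGroup
  let : InnerProductSpace ℂ V := InnerProductSpace.ofCore c.toCore
  have norm_le {R : V →ₗ[ℂ] V} (hR : ∀ x, (c.inner (R x) (R x)).re ≤ (c.inner x x).re) (x : V) :
      ‖R x‖ ≤ ‖x‖ := Real.sqrt_le_sqrt (hR x)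
  obtain ⟨P, h1, h2, h3, h4, h5, h6⟩ :=
    _root_.exists_ergodic_projection (norm_le hS) (norm_le hT) hSi hTi
  refine ⟨P, h1, h2, h3, h4, h5, fun f v => ?_⟩
  have := (LinearMap.continuous_of_finiteDimensional f).continuousAt.tendsto.comp (h6 v)
  simpa [Function.comp_def] using this

section ConvolutionOperator

omit [StarRing A] [StarModule ℂ A] [FiniteDimensional ℂ A]

/-- The functional `φ ⊗ ψ` on `A ⊗ A`. -/
def tensorFunctional (φ ψ : A →ₗ[ℂ] ℂ) : A ⊗[ℂ] A →ₗ[ℂ] ℂ :=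
  LinearMap.mul' ℂ ℂ ∘ₗ TensorProduct.map φ ψ

@[simp]
theorem tensorFunctional_tmul (φ ψ : A →ₗ[ℂ] ℂ) (a b : A) :
    tensorFunctional φ ψ (a ⊗ₜ[ℂ] b) = φ a * ψ b := by
  simp [tensorFunctional]

theorem conv_apply (φ ψ : A →ₗ[ℂ] ℂ) (a : A) :
    conv φ ψ a = tensorFunctional φ ψ (Coalgebra.comul a) := rfl

/-- The slice map `id ⊗ φ : A ⊗ A → A`. -/
def sliceRight (φ : A →ₗ[ℂ] ℂ) : A ⊗[ℂ] A →ₗ[ℂ] A :=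
  (TensorProduct.rid ℂ A).toLinearMap ∘ₗ TensorProduct.map LinearMap.id φ

@[simp]
theorem sliceRight_tmul (φ : A →ₗ[ℂ] ℂ) (a b : A) :
    sliceRight φ (a ⊗ₜ[ℂ] b) = φ b • a := by
  simp [sliceRight]

/-- The convolution operator `a ↦ (id ⊗ φ)(Δ a)` of a functional. -/
def convOp (φ : A →ₗ[ℂ] ℂ) : A →ₗ[ℂ] A := sliceRight φ ∘ₗ Coalgebra.comul

theorem convOp_apply (φ : A →ₗ[ℂ] ℂ) (a : A) :
    convOp φ a = sliceRight φ (Coalgebra.comul a) := rfl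

theorem apply_convOp (φ ψ : A →ₗ[ℂ] ℂ) (a : A) : φ (convOp ψ a) = conv φ ψ a := by
  rw [convOp_apply, conv_apply]
  induction Coalgebra.comul (R := ℂ) a with
  | zero => simp
  | tmul x y => simp [mul_comm]
  | add x y hx hy => simp [hx, hy]

theorem convOp_counit : convOp (Coalgebra.counit : A →ₗ[ℂ] ℂ) = LinearMap.id := by
  ext a
  have := Coalgebra.lTensor_counit_comul (R := ℂ) a
  simpa [convOp, sliceRight, LinearMap.lTensor] using
    congrArg (TensorProduct.rid ℂ A) this

theorem counit_conv (φ : A →ₗ[ℂ] ℂ) : conv Coalgebra.counit φ = φ := by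
  ext a
  have := Coalgebra.rTensor_counit_comul (R := ℂ) a
  have h2 (t : A ⊗[ℂ] A) : tensorFunctional Coalgebra.counit φ t
      = φ (TensorProduct.lid ℂ A (Coalgebra.counit.rTensor A t)) := by
    induction t with
    | zero => simp
    | tmul x y => simp
    | add x y hx hy => simp [hx, hy]
  rw [conv_apply, h2, this]
  simp

theorem counit_convOp (φ : A →ₗ[ℂ] ℂ) : Coalgebra.counit ∘ₗ convOp φ = φ := by
  ext a
  rw [LinearMap.comp_apply, apply_convOp, counit_conv]

theorem convOp_injective : Function.Injective (convOp (A := A)) := fun φ ψ hφψ => by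
  rw [← counit_convOp φ, hφψ, counit_convOp]

theorem convOp_conv (φ ψ : A →ₗ[ℂ] ℂ) : convOp (conv φ ψ) = convOp φ ∘ₗ convOp ψ := by
  let F : A ⊗[ℂ] (A ⊗[ℂ] A) →ₗ[ℂ] A :=
    (TensorProduct.rid ℂ A).toLinearMap ∘ₗ TensorProduct.map LinearMap.id (tensorFunctional φ ψ)
  have hl (t : A ⊗[ℂ] A) : sliceRight (conv φ ψ) t = F (Coalgebra.comul.lTensor A t) := by
    induction t with
    | zero => simp
    | tmul x y => simp [F, conv_apply]
    | add x y hx hy => simp [hx, hy]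
  have hr' (s : A ⊗[ℂ] A) (y : A) :
      ψ y • sliceRight φ s = F (TensorProduct.assoc ℂ A A A (s ⊗ₜ[ℂ] y)) := by
    induction s with
    | zero => simp
    | tmul x z => simp [F, smul_smul, mul_comm]
    | add x z hx hz => simp [TensorProduct.add_tmul, hx, hz]
  have hr (t : A ⊗[ℂ] A) : convOp φ (sliceRight ψ t)
      = F (TensorProduct.assoc ℂ A A A (Coalgebra.comul.rTensor A t)) := by
    induction t with
    | zero => simp
    | tmul x y => rw [LinearMap.rTensor_tmul, ← hr', sliceRight_tmul, map_smul, convOp_apply]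
    | add x y hx hy => simp [hx, hy]
  ext a
  rw [LinearMap.comp_apply, convOp_apply ψ, hr, Coalgebra.coassoc_apply, convOp_apply, hl]

theorem convOp_convPow (φ : A →ₗ[ℂ] ℂ) (k : ℕ) : convOp (convPow φ k) = convOp φ ^ k := by
  induction k with
  | zero => exact convOp_counit
  | succ k ih => rw [convPow, convOp_conv, ih, pow_succ]; rfl

theorem convPow_apply (φ : A →ₗ[ℂ] ℂ) (k : ℕ) (a : A) :
    convPow φ k a = Coalgebra.counit (R := ℂ) ((convOp φ ^ k) a) := by
  rw [← convOp_convPow, ← LinearMap.comp_apply, counit_convOp]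

theorem convOp_smul_sum {ι : Type*} (c : ℂ) (s : Finset ι) (F : ι → A →ₗ[ℂ] ℂ) (a : A) :
    convOp (c • ∑ i ∈ s, F i) a = c • ∑ i ∈ s, convOp (F i) a := by
  simp only [convOp_apply]
  induction Coalgebra.comul (R := ℂ) a with
  | zero => simp
  | tmul x y => simp [Finset.sum_smul, mul_smul]
  | add x y hx hy => simp only [map_add, hx, hy, Finset.sum_add_distrib, smul_add]

theorem tendsto_convOp {ι : Type*} {l : Filter ι} {F : ι → A →ₗ[ℂ] ℂ} {ψ : A →ₗ[ℂ] ℂ}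
    (hF : ∀ a, Filter.Tendsto (fun i => F i a) l (nhds (ψ a))) (f : A →ₗ[ℂ] ℂ) (a : A) :
    Filter.Tendsto (fun i => f (convOp (F i) a)) l (nhds (f (convOp ψ a))) := by
  simp only [convOp_apply]
  induction Coalgebra.comul (R := ℂ) a with
  | zero => simpa using tendsto_const_nhds
  | tmul x y => simpa using (hF y).mul_const (f x)
  | add x y hx hy => simpa using hx.add hy

end ConvolutionOperator

section States

omit [FiniteDimensional ℂ A]

variable {φ ψ : A →ₗ[ℂ] ℂ}

theorem IsState.map_star (hφ : IsState φ) (a : A) : φ (star a) = star (φ a) := by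
  have key (c : ℂ) : (star c * φ (star a) + c * φ a).im = 0 := by
    have h0 := (Complex.nonneg_iff.1 (hφ.2 a)).2
    have h1 := (Complex.nonneg_iff.1 (hφ.2 (1 + c • a))).2
    have h2 := (Complex.nonneg_iff.1 (hφ.2 (c • a))).2
    have h3 : star (1 + c • a) * (1 + c • a)
        = 1 + (star c • star a + c • a) + star (c • a) * (c • a) := by
      simp only [star_add, star_one, star_smul, add_mul, mul_add, one_mul, mul_one]
      abel
    rw [h3] at h1
    simp only [map_add, map_smul, smul_eq_mul, hφ.1, Complex.add_im, Complex.one_im] at h1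
    rw [Complex.add_im]
    linarith
  have h1 := key 1
  have hI := key Complex.I
  simp at h1 hI
  apply Complex.ext
  · simp; linarith
  · simp; linarith

theorem IsState.posSemidef (hφ : IsState φ) {n : ℕ} (v : Fin n → A) :
    (Matrix.of fun i j => φ (star (v i) * v j)).PosSemidef := by
  refine .of_dotProduct_mulVec_nonneg ?_ fun x => ?_
  · ext i j
    simp [Matrix.conjTranspose_apply, ← hφ.map_star]
  · convert hφ.2 (∑ i, x i • v i) using 1
    simp [dotProduct, Matrix.mulVec, Finset.sum_mul, Finset.mul_sum, star_sum]
    rw [Finset.sum_comm]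
    exact Finset.sum_congr rfl fun i _ => Finset.sum_congr rfl fun j _ => by ring

theorem tensorFunctional_star_mul_self_nonneg {tstar : A ⊗[ℂ] A →+ A ⊗[ℂ] A}
    (hstar : StarAxioms tstar) (hφ : IsState φ) (hψ : IsState ψ) (x : A ⊗[ℂ] A) :
    0 ≤ tensorFunctional φ ψ (tstar x * x) := by
  obtain ⟨n, u, v, rfl⟩ := TensorProduct.exists_sum_tmul_eq x
  convert ((hφ.posSemidef u).hadamard (hψ.posSemidef v)).dotProduct_mulVec_nonneg
    (fun _ => 1) using 1
  simp [map_sum, hstar.tstar_tmul, Finset.sum_mul_sum, dotProduct, Matrix.mulVec,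
    Algebra.TensorProduct.tmul_mul_tmul]

theorem IsState.conv {tstar : A ⊗[ℂ] A →+ A ⊗[ℂ] A} (hstar : StarAxioms tstar)
    (hφ : IsState φ) (hψ : IsState ψ) : IsState (conv φ ψ) := by
  refine ⟨?_, fun a => ?_⟩
  · simp [conv_apply, Algebra.TensorProduct.one_def, hφ.1, hψ.1]
  · rw [conv_apply, Bialgebra.comul_mul, hstar.comul_star]
    exact tensorFunctional_star_mul_self_nonneg hstar hφ hψ _

theorem IsState.convOp_star {tstar : A ⊗[ℂ] A →+ A ⊗[ℂ] A} (hstar : StarAxioms tstar)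
    (hφ : IsState φ) (a : A) : convOp φ (star a) = star (convOp φ a) := by
  rw [convOp_apply, convOp_apply, hstar.comul_star]
  induction Coalgebra.comul (R := ℂ) a with
  | zero => simp
  | tmul x y => simp [hstar.tstar_tmul, hφ.map_star]
  | add x y hx hy => simp [hx, hy]

theorem IsHaarState.convOp_contraction {h : A →ₗ[ℂ] ℂ} (hh : IsHaarState h)
    {tstar : A ⊗[ℂ] A →+ A ⊗[ℂ] A} (hstar : StarAxioms tstar)
    (hφ : IsState φ) (a : A) :
    (h (star (convOp φ a) * convOp φ a)).re ≤ (h (star a * a)).re := by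
  have hl (b : A) (t : A ⊗[ℂ] A) :
      tensorFunctional h φ (b ⊗ₜ[ℂ] 1 * t) = h (b * sliceRight φ t) := by
    induction t with
    | zero => simp
    | tmul x y => simp [mul_comm]
    | add x y hx hy => simp [mul_add, hx, hy]
  have hr (b : A) (t : A ⊗[ℂ] A) :
      tensorFunctional h φ (t * b ⊗ₜ[ℂ] 1) = h (sliceRight φ t * b) := by
    induction t with
    | zero => simp
    | tmul x y => simp [mul_comm]
    | add x y hx hy => simp [add_mul, hx, hy]
  have hinv (b : A) : tensorFunctional h φ (Coalgebra.comul b) = h b := by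
    have h1 (t : A ⊗[ℂ] A) : tensorFunctional h φ t
        = φ (TensorProduct.lid ℂ A (TensorProduct.map h LinearMap.id t)) := by
      induction t with
      | zero => simp
      | tmul x y => simp
      | add x y hx hy => simp [hx, hy]
    rw [h1, hh.left_inv, map_smul, hφ.1, smul_eq_mul, mul_one]
  have key := tensorFunctional_star_mul_self_nonneg hstar hh.state hφ
    (Coalgebra.comul a - convOp φ a ⊗ₜ[ℂ] 1)
  rw [map_sub, hstar.tstar_tmul, ← hstar.comul_star, star_one, sub_mul, mul_sub, mul_sub,
    ← Bialgebra.comul_mul, map_sub, map_sub, map_sub, hinv, hr, hl, hl, ← convOp_apply,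
    ← convOp_apply, hφ.convOp_star hstar, sliceRight_tmul, hφ.1, one_smul, sub_self, sub_zero,
    sub_nonneg] at key
  exact (Complex.le_def.1 key).1

/-- The `L²` inner product `⟨a, b⟩ = h(a* b)` of a faithful state. -/
@[reducible]
def IsHaarState.innerCore {h : A →ₗ[ℂ] ℂ} (hh : IsHaarState h) : InnerProductSpace.Core ℂ A where
  inner a b := h (star a * b)
  conj_inner_symm a b := by
    change star (h (star b * a)) = _
    rw [← hh.state.map_star, star_mul, star_star]
  re_inner_nonneg a := (Complex.nonneg_iff.1 (hh.state.2 a)).1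
  add_left a b c := by rw [star_add, add_mul, map_add]
  smul_left a b r := by rw [star_smul, smul_mul_assoc, map_smul, smul_eq_mul]; rfl
  definite a := hh.faithful a

end States

/-- The supremum `φ₁ ∨ φ₂` of two idempotent states: the Cesàro limit of the convolution
powers of `φ₁ ⋆ φ₂` is an idempotent state `ψ` satisfying `φᵢ ⋆ ψ = ψ = ψ ⋆ φᵢ`, and
minimal with this property among idempotent states dominating `φ₁` and `φ₂`. -/
theorem exists_sup_idempotent_state
    (h : A →ₗ[ℂ] ℂ) (hh : IsHaarState h)
    (tstar : A ⊗[ℂ] A →+ A ⊗[ℂ] A) (hstar : StarAxioms tstar)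
    (φ₁ φ₂ : A →ₗ[ℂ] ℂ)
    (hφ₁ : IsIdempotentState φ₁) (hφ₂ : IsIdempotentState φ₂) :
    ∃ ψ : A →ₗ[ℂ] ℂ, IsIdempotentState ψ ∧
      (∀ a : A, Filter.Tendsto
        (fun n : ℕ => (n : ℂ)⁻¹ * ∑ k ∈ Finset.range n, convPow (conv φ₁ φ₂) k a)
        Filter.atTop (nhds (ψ a))) ∧
      (conv φ₁ ψ = ψ ∧ conv ψ φ₁ = ψ ∧ conv φ₂ ψ = ψ ∧ conv ψ φ₂ = ψ) ∧
      (∀ φ₃ : A →ₗ[ℂ] ℂ, IsIdempotentState φ₃ →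
        conv φ₁ φ₃ = φ₃ → conv φ₂ φ₃ = φ₃ → conv ψ φ₃ = φ₃) := by
  set T := convOp (conv φ₁ φ₂) with hT
  have hTc : convOp φ₁ ∘ₗ convOp φ₂ = T := (convOp_conv φ₁ φ₂).symm
  obtain ⟨P, hP1, h1P, hP2, h2P, hPfix, hlim⟩ := hh.innerCore.exists_ergodic_projection
    (hh.convOp_contraction hstar hφ₁.1) (hh.convOp_contraction hstar hφ₂.1)
    (by rw [← convOp_conv, hφ₁.2]) (by rw [← convOp_conv, hφ₂.2])
  rw [hTc] at hlim
  set ψ : A →ₗ[ℂ] ℂ := Coalgebra.counit ∘ₗ P with hψ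
  have hψlim (a : A) : Filter.Tendsto
      (fun n : ℕ => (n : ℂ)⁻¹ * ∑ k ∈ Finset.range n, convPow (conv φ₁ φ₂) k a)
      Filter.atTop (nhds (ψ a)) := by
    simp only [convPow_apply]
    exact hlim Coalgebra.counit a
  have hψP : convOp ψ = P := by
    ext a
    refine sub_eq_zero.1 ((Module.forall_dual_apply_eq_zero_iff ℂ _).1 fun f => ?_)
    rw [map_sub, sub_eq_zero]
    refine tendsto_nhds_unique (tendsto_convOp
      (F := fun n : ℕ => (n : ℂ)⁻¹ • ∑ k ∈ Finset.range n, convPow (conv φ₁ φ₂) k)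
      (fun b => by simpa using hψlim b) f a) ?_
    simpa [convOp_smul_sum, convOp_convPow] using hlim f a
  have hst := hφ₁.1.conv hstar hφ₂.1
  have hone {χ : A →ₗ[ℂ] ℂ} (hχ : IsState χ) : convOp χ 1 = 1 := by
    simp [convOp_apply, Algebra.TensorProduct.one_def, hχ.1]
  have hψ1 : ψ 1 = 1 := by
    simp [hψ, hPfix 1 (hone hφ₁.1) (hone hφ₂.1)]
  have hPT : P ∘ₗ T = P := by rw [← hTc, ← LinearMap.comp_assoc, h1P, h2P]
  have hpow (k : ℕ) : IsState (convPow (conv φ₁ φ₂) (k + 1)) := by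
    induction k with
    | zero => rwa [convPow, convPow, counit_conv]
    | succ k ih => exact ih.conv hstar hst
  have hψpos (a : A) : 0 ≤ ψ (star a * a) := by
    have hfix : ψ (T (star a * a)) = ψ (star a * a) :=
      congrArg Coalgebra.counit (LinearMap.congr_fun hPT (star a * a))
    rw [← hfix]
    refine ge_of_tendsto' (hψlim _) fun n => ?_
    have hn : (0 : ℂ) ≤ (n : ℂ)⁻¹ := by positivity
    refine mul_nonneg hn (Finset.sum_nonneg fun k _ => ?_)
    rw [hT, apply_convOp]
    exact (hpow k).2 a
  refine ⟨ψ, ⟨⟨hψ1, hψpos⟩, ?_⟩, hψlim, ⟨?_, ?_, ?_, ?_⟩, fun φ₃ _ h1 h2 => ?_⟩ <;>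
    refine convOp_injective ?_ <;> rw [convOp_conv, hψP]
  · ext a
    exact hPfix _ (LinearMap.congr_fun hP1 a) (LinearMap.congr_fun hP2 a)
  · exact hP1
  · exact h1P
  · exact hP2
  · exact h2P
  · ext a
    refine hPfix _ ?_ ?_
    · exact LinearMap.congr_fun ((convOp_conv _ _).symm.trans (congrArg convOp h1)) a
    · exact LinearMap.congr_fun ((convOp_conv _ _).symm.trans (congrArg convOp h2)) a
end
end

section
/- Let φ be an idempotent state on a finite quantum group A. Then for every a ∈ A, both (φ ⊗ id)(Δ(a)) − φ(a)·1 and (id ⊗ φ)(Δ(a)) − φ(a)·1 belong to the null space N_φ. -/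
open TensorProduct HopfAlgebra
open scoped ComplexOrder

noncomputable section

variable {A : Type*} [Ring A] [StarRing A] [HopfAlgebra ℂ A]
  [StarModule ℂ A] [FiniteDimensional ℂ A]

section TensorSlices

variable {C : Type*} [AddCommGroup C] [Module ℂ C]

theorem rid_map_id_comm (φ : C →ₗ[ℂ] ℂ) (X : C ⊗[ℂ] C) :
    TensorProduct.rid ℂ C (TensorProduct.map LinearMap.id φ (TensorProduct.comm ℂ C C X)) =
      TensorProduct.lid ℂ C (TensorProduct.map φ LinearMap.id X) := by
  induction X with
  | zero => simp
  | tmul x y => simp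
  | add x y hx hy => simp only [map_add, hx, hy]

theorem lid_map_id_comm (φ : C →ₗ[ℂ] ℂ) (X : C ⊗[ℂ] C) :
    TensorProduct.lid ℂ C (TensorProduct.map φ LinearMap.id (TensorProduct.comm ℂ C C X)) =
      TensorProduct.rid ℂ C (TensorProduct.map LinearMap.id φ X) := by
  rw [← rid_map_id_comm, TensorProduct.comm_comm]

theorem map_rid_map_id (h φ : C →ₗ[ℂ] ℂ) (X : C ⊗[ℂ] C) :
    h (TensorProduct.rid ℂ C (TensorProduct.map LinearMap.id φ X)) =
      φ (TensorProduct.lid ℂ C (TensorProduct.map h LinearMap.id X)) := by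
  induction X with
  | zero => simp
  | tmul x y => simp [mul_comm]
  | add x y hx hy => simp only [map_add, hx, hy]

variable {B : Type*} [Ring B] [Algebra ℂ B]

theorem rid_map_id_mul_tmul_one (φ : B →ₗ[ℂ] ℂ) (X : B ⊗[ℂ] B) (b : B) :
    TensorProduct.rid ℂ B (TensorProduct.map LinearMap.id φ (X * b ⊗ₜ[ℂ] 1)) =
      TensorProduct.rid ℂ B (TensorProduct.map LinearMap.id φ X) * b := by
  induction X with
  | zero => simp
  | tmul x y => simp
  | add x y hx hy => simp [hx, hy, add_mul]

theorem rid_map_id_tmul_one_mul (φ : B →ₗ[ℂ] ℂ) (X : B ⊗[ℂ] B) (b : B) :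
    TensorProduct.rid ℂ B (TensorProduct.map LinearMap.id φ (b ⊗ₜ[ℂ] 1 * X)) =
      b * TensorProduct.rid ℂ B (TensorProduct.map LinearMap.id φ X) := by
  induction X with
  | zero => simp
  | tmul x y => simp
  | add x y hx hy => simp [hx, hy, mul_add]

/-- An algebra character applied to `(id ⊗ φ)((1 ⊗ d) X)` is `φ (d · (ε ⊗ id) X)`. -/
theorem character_rid_map_id_tmul_mul (ε : B →ₐ[ℂ] ℂ) (φ : B →ₗ[ℂ] ℂ) (X : B ⊗[ℂ] B) (d : B) :
    ε (TensorProduct.rid ℂ B (TensorProduct.map LinearMap.id φ ((1 ⊗ₜ[ℂ] d) * X))) =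
      φ (d * TensorProduct.lid ℂ B (TensorProduct.map ε.toLinearMap LinearMap.id X)) := by
  induction X with
  | zero => simp
  | tmul x y => simp [mul_comm]
  | add x y hx hy => simp only [map_add, mul_add, hx, hy]

end TensorSlices

section PositiveFunctionals

variable {B : Type*} [Ring B] [StarRing B] [Algebra ℂ B] [StarModule ℂ B]

/-- A positive functional on a complex `*`-algebra is hermitian. -/
theorem map_star_of_nonneg (φ : B →ₗ[ℂ] ℂ) (hφ : ∀ a : B, 0 ≤ φ (star a * a)) (x : B) :
    φ (star x) = star (φ x) := by
  have h0 := (Complex.nonneg_iff.1 (hφ 1)).2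
  have h1 := (Complex.nonneg_iff.1 (hφ x)).2
  have h2 := (Complex.nonneg_iff.1 (hφ (1 + x))).2
  have h3 := (Complex.nonneg_iff.1 (hφ (1 + Complex.I • x))).2
  simp [mul_add, add_mul, star_smul] at h0 h1 h2 h3
  apply Complex.ext <;> simp <;> linarith

/-- The semi-inner product `⟪a, b⟫ = φ (a* b)` of a positive functional. -/
abbrev preInnerCoreOfNonneg (φ : B →ₗ[ℂ] ℂ) (hφ : ∀ a : B, 0 ≤ φ (star a * a)) :
    PreInnerProductSpace.Core ℂ B where
  inner a b := φ (star a * b)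
  conj_inner_symm a b := by
    rw [← star_star a, ← star_mul, map_star_of_nonneg φ hφ, star_star]; simp
  re_inner_nonneg a := (Complex.nonneg_iff.1 (hφ a)).1
  add_left a b c := by simp [add_mul]
  smul_left a b r := by simp [star_smul]

/-- A positive functional `φ` vanishes on `d * y` for every null vector `y` of `φ`. -/
theorem map_mul_eq_zero_of_map_star_mul_self_eq_zero (φ : B →ₗ[ℂ] ℂ)
    (hφ : ∀ a : B, 0 ≤ φ (star a * a)) {y : B} (hy : φ (star y * y) = 0) (d : B) :
    φ (d * y) = 0 := by
  have key := @InnerProductSpace.Core.inner_mul_inner_self_le ℂ B _ _ _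
    (preInnerCoreOfNonneg φ hφ) (star d) y
  change ‖φ (star (star d) * y)‖ * ‖φ (star y * star d)‖ ≤
    RCLike.re (φ (star (star d) * star d)) * RCLike.re (φ (star y * y)) at key
  rw [hy, ← star_mul, map_star_of_nonneg φ hφ, star_star, norm_star] at key
  simp only [map_zero, mul_zero] at key
  exact norm_eq_zero.1 (mul_self_eq_zero.1 (le_antisymm key (by positivity)))

/-- A faithful positive functional on a finite-dimensional `*`-algebra has an orthonormal basis. -/
theorem exists_basis_map_star_mul_eq_ite [FiniteDimensional ℂ B] (h : B →ₗ[ℂ] ℂ)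
    (hpos : ∀ a : B, 0 ≤ h (star a * a)) (hfaith : ∀ a : B, h (star a * a) = 0 → a = 0) :
    ∃ (n : ℕ) (e : Module.Basis (Fin n) ℂ B),
      ∀ i j, h (star (e i) * e j) = if i = j then 1 else 0 := by
  let core : InnerProductSpace.Core ℂ B :=
    { preInnerCoreOfNonneg h hpos with definite := hfaith }
  let : NormedAddCommGroup B := core.toNormedAddCommGroup
  let : InnerProductSpace ℂ B := InnerProductSpace.ofCore core.toCore
  refine ⟨_, (stdOrthonormalBasis ℂ B).toBasis, fun i j => ?_⟩
  have := orthonormal_iff_ite.1 (stdOrthonormalBasis ℂ B).orthonormal i j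
  rw [OrthonormalBasis.coe_toBasis]
  exact this

/-- If `X` is a null vector of `h ⊗ φ` with `h` faithful, then `(id ⊗ φ)((1 ⊗ d) X) = 0`. -/
theorem rid_map_id_tmul_mul_eq_zero [FiniteDimensional ℂ B] (h φ : B →ₗ[ℂ] ℂ)
    (hpos : ∀ a : B, 0 ≤ h (star a * a)) (hfaith : ∀ a : B, h (star a * a) = 0 → a = 0)
    (hφ : ∀ a : B, 0 ≤ φ (star a * a))
    (tstar : B ⊗[ℂ] B →+ B ⊗[ℂ] B)
    (htstar : ∀ a b : B, tstar (a ⊗ₜ[ℂ] b) = star a ⊗ₜ[ℂ] star b) (X : B ⊗[ℂ] B)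
    (hX : h (TensorProduct.rid ℂ B (TensorProduct.map LinearMap.id φ (tstar X * X))) = 0)
    (d : B) :
    TensorProduct.rid ℂ B (TensorProduct.map LinearMap.id φ ((1 ⊗ₜ[ℂ] d) * X)) = 0 := by
  obtain ⟨n, e, he⟩ := exists_basis_map_star_mul_eq_ite h hpos hfaith
  obtain ⟨c, rfl⟩ := TensorProduct.eq_repr_basis_left e X
  rw [Finsupp.sum_fintype _ _ (by simp)] at hX ⊢
  simp only [map_sum, htstar, Finset.sum_mul, Finset.mul_sum, Algebra.TensorProduct.tmul_mul_tmul,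
    TensorProduct.map_tmul, LinearMap.id_apply, TensorProduct.rid_tmul, map_smul, he,
    smul_eq_mul, mul_ite, mul_one, mul_zero, Finset.sum_ite_eq',
    Finset.mem_univ, if_true] at hX
  have hc := (Finset.sum_eq_zero_iff_of_nonneg fun i _ => hφ (c i)).1 hX
  simp only [map_sum, Finset.mul_sum, Algebra.TensorProduct.tmul_mul_tmul,
    TensorProduct.map_tmul, LinearMap.id_apply, TensorProduct.rid_tmul]
  refine Finset.sum_eq_zero fun i hi => ?_
  rw [map_mul_eq_zero_of_map_star_mul_self_eq_zero φ hφ (hc i hi), zero_smul]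

theorem rid_map_id_tstar (φ : B →ₗ[ℂ] ℂ) (hφ : ∀ a : B, 0 ≤ φ (star a * a))
    (tstar : B ⊗[ℂ] B →+ B ⊗[ℂ] B)
    (htstar : ∀ a b : B, tstar (a ⊗ₜ[ℂ] b) = star a ⊗ₜ[ℂ] star b) (X : B ⊗[ℂ] B) :
    TensorProduct.rid ℂ B (TensorProduct.map LinearMap.id φ (tstar X)) =
      star (TensorProduct.rid ℂ B (TensorProduct.map LinearMap.id φ X)) := by
  induction X with
  | zero => simp
  | tmul a b => simp [htstar, map_star_of_nonneg φ hφ, star_smul]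
  | add x y hx hy => simp [hx, hy]

/-- Let `δ` be a `*`-homomorphism `B → B ⊗ B` with left counit `ε`, let `h` be a faithful positive
functional preserved by the slice map `R = (id ⊗ φ) ∘ δ` of a state `φ`. If `R` is idempotent, then
`R a - ε (R a)` is a null vector of `φ`. -/
theorem map_star_mul_self_slice_sub_eq_zero [FiniteDimensional ℂ B] (h φ : B →ₗ[ℂ] ℂ)
    (hpos : ∀ a : B, 0 ≤ h (star a * a)) (hfaith : ∀ a : B, h (star a * a) = 0 → a = 0)
    (hφ : ∀ a : B, 0 ≤ φ (star a * a)) (hφ1 : φ 1 = 1)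
    (tstar : B ⊗[ℂ] B →+ B ⊗[ℂ] B)
    (htstar : ∀ a b : B, tstar (a ⊗ₜ[ℂ] b) = star a ⊗ₜ[ℂ] star b)
    (δ : B →ₐ[ℂ] B ⊗[ℂ] B) (hδ : ∀ a, δ (star a) = tstar (δ a))
    (ε : B →ₐ[ℂ] ℂ)
    (hε : ∀ a, TensorProduct.lid ℂ B (TensorProduct.map ε.toLinearMap LinearMap.id (δ a)) = a)
    (R : B → B)
    (hR : ∀ a, TensorProduct.rid ℂ B (TensorProduct.map LinearMap.id φ (δ a)) = R a)
    (hRR : ∀ a, R (R a) = R a) (hhR : ∀ a, h (R a) = h a) (a : B) :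
    φ (star (R a - ε (R a) • 1) * (R a - ε (R a) • 1)) = 0 := by
  generalize hb : R a = b
  have hRb : R b = b := by rw [← hb, hRR]
  have hRsb : R (star b) = star b := by
    rw [← hR, hδ, rid_map_id_tstar φ hφ tstar htstar, hR, hRb]
  have slice_one (c : B) :
      TensorProduct.rid ℂ B (TensorProduct.map LinearMap.id φ (c ⊗ₜ[ℂ] 1)) = c := by
    simp [hφ1]
  have null (d : B) := rid_map_id_tmul_mul_eq_zero h φ hpos hfaith hφ tstar htstar
    (δ b - b ⊗ₜ[ℂ] 1) (by
      have hexp : tstar (δ b - b ⊗ₜ[ℂ] 1) * (δ b - b ⊗ₜ[ℂ] 1) =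
          δ (star b * b) - δ (star b) * b ⊗ₜ[ℂ] 1 - star b ⊗ₜ[ℂ] 1 * δ b +
            (star b * b) ⊗ₜ[ℂ] 1 := by
        rw [map_sub, htstar, ← hδ, star_one, map_mul, mul_sub, sub_mul, sub_mul,
          Algebra.TensorProduct.tmul_mul_tmul, one_mul]
        abel
      rw [hexp]
      simp only [map_add, map_sub, rid_map_id_mul_tmul_one, rid_map_id_tmul_one_mul,
        slice_one, hR, hRb, hRsb, hhR]
      ring) d
  have hmul (d : B) : φ (d * b) = φ d * ε b := by
    have := congrArg ε (null d)
    rw [character_rid_map_id_tmul_mul, map_sub, map_sub, hε] at this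
    simpa [mul_sub, sub_eq_zero, mul_comm] using this
  rw [mul_sub, map_sub, hmul, mul_smul_comm, mul_one, map_smul, smul_eq_mul]
  ring

end PositiveFunctionals

section CoalgebraSlices

variable {C : Type*} [AddCommGroup C] [Module ℂ C] [Coalgebra ℂ C]

/-- The slice maps `(id ⊗ φ) ∘ Δ` compose through convolution. -/
theorem rid_map_comul_rid_map_comul (φ : C →ₗ[ℂ] ℂ) (a : C) :
    TensorProduct.rid ℂ C (TensorProduct.map LinearMap.id φ (Coalgebra.comul
      (TensorProduct.rid ℂ C (TensorProduct.map LinearMap.id φ (Coalgebra.comul (R := ℂ) a))))) =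
    TensorProduct.rid ℂ C (TensorProduct.map LinearMap.id
      (LinearMap.mul' ℂ ℂ ∘ₗ TensorProduct.map φ φ ∘ₗ Coalgebra.comul) (Coalgebra.comul a)) := by
  let G : C ⊗[ℂ] (C ⊗[ℂ] C) →ₗ[ℂ] C := (TensorProduct.rid ℂ C).toLinearMap ∘ₗ
    TensorProduct.map LinearMap.id (LinearMap.mul' ℂ ℂ ∘ₗ TensorProduct.map φ φ)
  have hl (X : C ⊗[ℂ] C) (z : C) : G (TensorProduct.assoc ℂ C C C (X ⊗ₜ z)) =
      φ z • TensorProduct.rid ℂ C (TensorProduct.map LinearMap.id φ X) := by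
    induction X with
    | zero => simp
    | tmul x y => simp [G, smul_smul, mul_comm]
    | add x y hx hy => simp only [TensorProduct.add_tmul, map_add, hx, hy, smul_add]
  have hl' (X : C ⊗[ℂ] C) :
      TensorProduct.rid ℂ C (TensorProduct.map LinearMap.id φ (Coalgebra.comul
        (TensorProduct.rid ℂ C (TensorProduct.map LinearMap.id φ X)))) =
      G (TensorProduct.assoc ℂ C C C (Coalgebra.comul.rTensor C X)) := by
    induction X with
    | zero => simp
    | tmul x y => simp [hl]
    | add x y hx hy => simp only [map_add, hx, hy]
  have hr (X : C ⊗[ℂ] C) : TensorProduct.rid ℂ C (TensorProduct.map LinearMap.id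
      (LinearMap.mul' ℂ ℂ ∘ₗ TensorProduct.map φ φ ∘ₗ Coalgebra.comul) X) =
      G (Coalgebra.comul.lTensor C X) := by
    induction X with
    | zero => simp
    | tmul x y => simp [G]
    | add x y hx hy => simp only [map_add, hx, hy]
  rw [hl', hr, Coalgebra.coassoc_apply]

/-- The slice maps `(φ ⊗ id) ∘ Δ` compose through convolution. -/
theorem lid_map_comul_lid_map_comul (φ : C →ₗ[ℂ] ℂ) (a : C) :
    TensorProduct.lid ℂ C (TensorProduct.map φ LinearMap.id (Coalgebra.comul
      (TensorProduct.lid ℂ C (TensorProduct.map φ LinearMap.id (Coalgebra.comul (R := ℂ) a))))) =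
    TensorProduct.lid ℂ C (TensorProduct.map
      (LinearMap.mul' ℂ ℂ ∘ₗ TensorProduct.map φ φ ∘ₗ Coalgebra.comul) LinearMap.id
      (Coalgebra.comul a)) := by
  let G : (C ⊗[ℂ] C) ⊗[ℂ] C →ₗ[ℂ] C := (TensorProduct.lid ℂ C).toLinearMap ∘ₗ
    TensorProduct.map (LinearMap.mul' ℂ ℂ ∘ₗ TensorProduct.map φ φ) LinearMap.id
  have hl (z : C) (X : C ⊗[ℂ] C) : G ((TensorProduct.assoc ℂ C C C).symm (z ⊗ₜ X)) =
      φ z • TensorProduct.lid ℂ C (TensorProduct.map φ LinearMap.id X) := by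
    induction X with
    | zero => simp
    | tmul x y => simp [G, smul_smul]
    | add x y hx hy => simp only [TensorProduct.tmul_add, map_add, hx, hy, smul_add]
  have hl' (X : C ⊗[ℂ] C) :
      TensorProduct.lid ℂ C (TensorProduct.map φ LinearMap.id (Coalgebra.comul
        (TensorProduct.lid ℂ C (TensorProduct.map φ LinearMap.id X)))) =
      G ((TensorProduct.assoc ℂ C C C).symm (Coalgebra.comul.lTensor C X)) := by
    induction X with
    | zero => simp
    | tmul x y => simp [hl]
    | add x y hx hy => simp only [map_add, hx, hy]
  have hr (X : C ⊗[ℂ] C) : TensorProduct.lid ℂ C (TensorProduct.map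
      (LinearMap.mul' ℂ ℂ ∘ₗ TensorProduct.map φ φ ∘ₗ Coalgebra.comul) LinearMap.id X) =
      G (Coalgebra.comul.rTensor C X) := by
    induction X with
    | zero => simp
    | tmul x y => simp [G]
    | add x y hx hy => simp only [map_add, hx, hy]
  rw [hl', hr, Coalgebra.coassoc_symm_apply]

theorem lid_map_counit_comul (a : C) :
    TensorProduct.lid ℂ C (TensorProduct.map Coalgebra.counit LinearMap.id
      (Coalgebra.comul (R := ℂ) a)) = a := by
  have := congrArg (TensorProduct.lid ℂ C) (Coalgebra.rTensor_counit_comul (R := ℂ) a)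
  rwa [TensorProduct.lid_tmul, one_smul] at this

theorem rid_map_counit_comul (a : C) :
    TensorProduct.rid ℂ C (TensorProduct.map LinearMap.id Coalgebra.counit
      (Coalgebra.comul (R := ℂ) a)) = a := by
  have := congrArg (TensorProduct.rid ℂ C) (Coalgebra.lTensor_counit_comul (R := ℂ) a)
  rwa [TensorProduct.rid_tmul, one_smul] at this

end CoalgebraSlices

/-- For an idempotent state `φ` and any `a`, both `(φ ⊗ id)(Δ(a)) − φ(a)·1` and
`(id ⊗ φ)(Δ(a)) − φ(a)·1` lie in the null space `N_φ`. -/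
theorem slices_sub_scalar_mem_null_space
    (h : A →ₗ[ℂ] ℂ) (hh : IsHaarState h)
    (tstar : A ⊗[ℂ] A →+ A ⊗[ℂ] A) (hstar : StarAxioms tstar)
    (φ : A →ₗ[ℂ] ℂ) (hφ : IsIdempotentState φ) (a : A) :
    (TensorProduct.lid ℂ A (TensorProduct.map φ LinearMap.id (Coalgebra.comul a)) - φ a • 1)
        ∈ {x : A | φ (star x * x) = 0} ∧
    (TensorProduct.rid ℂ A (TensorProduct.map LinearMap.id φ (Coalgebra.comul a)) - φ a • 1)
        ∈ {x : A | φ (star x * x) = 0} := by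
  obtain ⟨⟨hφ1, hφpos⟩, hφφ⟩ := hφ
  unfold conv at hφφ
  constructor
  · have key := map_star_mul_self_slice_sub_eq_zero h φ hh.state.2 hh.faithful hφpos hφ1
      tstar hstar.tstar_tmul
      ((Algebra.TensorProduct.comm ℂ A A).toAlgHom.comp (Bialgebra.comulAlgHom ℂ A))
      (fun a => by
        change TensorProduct.comm ℂ A A (Coalgebra.comul (star a)) =
          tstar (TensorProduct.comm ℂ A A (Coalgebra.comul a))
        rw [hstar.comul_star]
        induction Coalgebra.comul (R := ℂ) a with
        | zero => simp
        | tmul x y => simp [hstar.tstar_tmul]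
        | add x y hx hy => simp only [map_add, hx, hy])
      (Bialgebra.counitAlgHom ℂ A)
      (fun a => (lid_map_id_comm _ _).trans (rid_map_counit_comul a))
      (fun a => TensorProduct.lid ℂ A (TensorProduct.map φ LinearMap.id (Coalgebra.comul a)))
      (fun a => rid_map_id_comm _ _)
      (fun a => by rw [lid_map_comul_lid_map_comul, hφφ])
      (fun a => by rw [← map_rid_map_id, hh.right_inv, map_smul, hφ1, smul_eq_mul, mul_one]) a
    have hε : Bialgebra.counitAlgHom ℂ A (TensorProduct.lid ℂ A
        (TensorProduct.map φ LinearMap.id (Coalgebra.comul a))) = φ a := by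
      rw [Bialgebra.counitAlgHom_apply, ← map_rid_map_id, rid_map_counit_comul]
    rwa [hε] at key
  · have key := map_star_mul_self_slice_sub_eq_zero h φ hh.state.2 hh.faithful hφpos hφ1
      tstar hstar.tstar_tmul (Bialgebra.comulAlgHom ℂ A) hstar.comul_star
      (Bialgebra.counitAlgHom ℂ A) lid_map_counit_comul
      (fun a => TensorProduct.rid ℂ A (TensorProduct.map LinearMap.id φ (Coalgebra.comul a)))
      (fun a => rfl)
      (fun a => by rw [rid_map_comul_rid_map_comul, hφφ])
      (fun a => by rw [map_rid_map_id, hh.left_inv, map_smul, hφ1, smul_eq_mul, mul_one]) a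
    have hε : Bialgebra.counitAlgHom ℂ A (TensorProduct.rid ℂ A
        (TensorProduct.map LinearMap.id φ (Coalgebra.comul a))) = φ a := by
      rw [Bialgebra.counitAlgHom_apply, map_rid_map_id, lid_map_counit_comul]
    rwa [hε] at key
end
end
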